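/- arXiv:1705.10175 — 3 statements merged into one kernel-verified Lean document; each statement's English description precedes it below -/
import Mathlib

section
/- Lemma (symmetry and positive semidefiniteness of the projector-splitting step): let d, r ∈ ℕ, τ ≥ 0, let Q ∈ ℝ^{d×d} and S₀ ∈ ℝ^{r×r} be symmetric positive semidefinite, let U₀, U₁ ∈ ℝ^{d×r} with U₁ᵀU₁ = I_r, and let Ŝ₁ ∈ ℝ^{r×r} satisfy U₁Ŝ₁ = U₀S₀ + τQU₀. Define S̃₀ = Ŝ₁ − τU₁ᵀQU₀ and S₁ = S̃₀U₀ᵀU₁ + τU₁ᵀQU₁. Then S₁ is symmetric and positive semidefinite. -/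
open Matrix

/-- Symmetry and positive semidefiniteness of the matrix `S₁` produced by one step of the
modified projector-splitting integrator for the subproblem `Ṅ = Q`. -/
theorem stmt_13 (d r : ℕ) (τ : ℝ) (hτ : 0 ≤ τ) (Q : Matrix (Fin d) (Fin d) ℝ)
    (hQ : Q.PosSemidef) (S₀ : Matrix (Fin r) (Fin r) ℝ) (hS₀ : S₀.PosSemidef)
    (U₀ U₁ : Matrix (Fin d) (Fin r) ℝ) (hU₁ : U₁ᵀ * U₁ = 1)
    (Shat₁ : Matrix (Fin r) (Fin r) ℝ) (hK : U₁ * Shat₁ = U₀ * S₀ + τ • (Q * U₀))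
    (Stil₀ S₁ : Matrix (Fin r) (Fin r) ℝ)
    (hStil₀ : Stil₀ = Shat₁ - τ • (U₁ᵀ * Q * U₀))
    (hS₁ : S₁ = Stil₀ * U₀ᵀ * U₁ + τ • (U₁ᵀ * Q * U₁)) :
    S₁.IsSymm ∧ S₁.PosSemidef := by
  have hShat₁ : Shat₁ = U₁ᵀ * U₀ * S₀ + τ • (U₁ᵀ * Q * U₀) := by
    calc Shat₁ = U₁ᵀ * (U₁ * Shat₁) := by rw [← Matrix.mul_assoc, hU₁, Matrix.one_mul]
      _ = _ := by rw [hK, Matrix.mul_add, Matrix.mul_smul, Matrix.mul_assoc, Matrix.mul_assoc]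
  have hS₁_eq : S₁ = (U₀ᵀ * U₁)ᴴ * S₀ * (U₀ᵀ * U₁) + τ • (U₁ᴴ * Q * U₁) := by
    rw [hS₁, hStil₀, hShat₁, add_sub_cancel_right]
    simp only [conjTranspose_eq_transpose_of_trivial, transpose_mul, transpose_transpose,
      Matrix.mul_assoc]
  have hpsd : S₁.PosSemidef := by
    rw [hS₁_eq]
    exact (hS₀.conjTranspose_mul_mul_same _).add ((hQ.conjTranspose_mul_mul_same _).smul hτ)
  exact ⟨(conjTranspose_eq_transpose_of_trivial S₁).symm.trans hpsd.isHermitian, hpsd⟩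
end

section
/- Positive semidefiniteness of the low-rank approximation produced by one step of the symmetry-preserving integrator: under the hypotheses that τ ≥ 0, Q ∈ ℝ^{d×d} and S₀ ∈ ℝ^{r×r} are symmetric positive semidefinite, U₀, U₁ ∈ ℝ^{d×r} with U₁ᵀU₁ = I_r, U₁Ŝ₁ = U₀S₀ + τQU₀, S̃₀ = Ŝ₁ − τU₁ᵀQU₀ and S₁ = S̃₀U₀ᵀU₁ + τU₁ᵀQU₁, the rank-r matrix N₁ = U₁S₁U₁ᵀ ∈ ℝ^{d×d} is symmetric and positive semidefinite, and its rank is at most r. -/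
open Matrix

/-- The low-rank approximation `N₁ = U₁ S₁ U₁ᵀ` produced by one step of the symmetry-preserving
projector-splitting integrator is symmetric, positive semidefinite, and has rank at most `r`. -/
theorem stmt_14 (d r : ℕ) (τ : ℝ) (hτ : 0 ≤ τ) (Q : Matrix (Fin d) (Fin d) ℝ)
    (hQ : Q.PosSemidef) (S₀ : Matrix (Fin r) (Fin r) ℝ) (hS₀ : S₀.PosSemidef)
    (U₀ U₁ : Matrix (Fin d) (Fin r) ℝ) (hU₁ : U₁ᵀ * U₁ = 1)
    (Shat₁ : Matrix (Fin r) (Fin r) ℝ) (hK : U₁ * Shat₁ = U₀ * S₀ + τ • (Q * U₀))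
    (Stil₀ S₁ : Matrix (Fin r) (Fin r) ℝ)
    (hStil₀ : Stil₀ = Shat₁ - τ • (U₁ᵀ * Q * U₀))
    (hS₁ : S₁ = Stil₀ * U₀ᵀ * U₁ + τ • (U₁ᵀ * Q * U₁))
    (N₁ : Matrix (Fin d) (Fin d) ℝ) (hN₁ : N₁ = U₁ * S₁ * U₁ᵀ) :
    N₁.IsSymm ∧ N₁.PosSemidef ∧ N₁.rank ≤ r := by
  have hShat₁ : Shat₁ = U₁ᵀ * U₀ * S₀ + τ • (U₁ᵀ * Q * U₀) := by
    calc Shat₁ = U₁ᵀ * (U₁ * Shat₁) := by rw [← Matrix.mul_assoc, hU₁, Matrix.one_mul]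
      _ = U₁ᵀ * U₀ * S₀ + τ • (U₁ᵀ * Q * U₀) := by
        rw [hK, Matrix.mul_add, Matrix.mul_smul, Matrix.mul_assoc, Matrix.mul_assoc]
  have hS₁_eq : S₁ = U₁ᵀ * (U₀ * S₀ * U₀ᵀ + τ • Q) * U₁ := by
    rw [hS₁, hStil₀, hShat₁, add_sub_cancel_right]
    simp only [Matrix.mul_add, Matrix.add_mul, Matrix.mul_smul, Matrix.smul_mul,
      Matrix.mul_assoc]
  have hS₁_psd : S₁.PosSemidef := by
    have h := ((hS₀.mul_mul_conjTranspose_same U₀).add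
      (hQ.smul hτ)).conjTranspose_mul_mul_same U₁
    simpa only [conjTranspose_eq_transpose_of_trivial, ← hS₁_eq] using h
  have hN₁_psd : N₁.PosSemidef := by
    simpa only [conjTranspose_eq_transpose_of_trivial, ← hN₁] using
      hS₁_psd.mul_mul_conjTranspose_same U₁
  refine ⟨by simpa only [IsSymm, IsHermitian, conjTranspose_eq_transpose_of_trivial] using
    hN₁_psd.isHermitian, hN₁_psd, ?_⟩
  rw [hN₁, Matrix.mul_assoc]
  exact (rank_mul_le_left _ _).trans U₁.rank_le_width
end

section
/- Best-approximation property of the tangent-space projection: let U, V ∈ ℝ^{d×r} have orthonormal columns (UᵀU = I_r, VᵀV = I_r) and define the linear map P(G) = G·V·Vᵀ − U·Uᵀ·G·V·Vᵀ + U·Uᵀ·G on ℝ^{d×d}. Then for every G ∈ ℝ^{d×d} and every W in the range of P, ‖G − P(G)‖_F ≤ ‖G − W‖_F, i.e., P(G) minimizes the Frobenius-norm distance to G over the range of P; equivalently, G − P(G) is Frobenius-orthogonal to the range of P. -/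
open Matrix

attribute [local instance] Matrix.frobeniusNormedAddCommGroup Matrix.frobeniusNormedSpace

/-- The squared Frobenius norm of a real matrix is `trace (Xᵀ X)`. -/
lemma frobenius_norm_sq_eq_trace {m n : Type*} [Fintype m] [Fintype n] (X : Matrix m n ℝ) :
    ‖X‖ ^ 2 = (Xᵀ * X).trace := by
  rw [frobenius_norm_def, ← Real.sqrt_eq_rpow, Real.sq_sqrt (by positivity), Finset.sum_comm]
  simp [Matrix.trace, Matrix.mul_apply, sq]

/-- Adding a Frobenius-orthogonal matrix does not decrease the Frobenius norm. -/
lemma frobenius_norm_le_norm_add_of_trace_eq_zero {m n : Type*} [Fintype m] [Fintype n]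
    {X Y : Matrix m n ℝ} (h : (Xᵀ * Y).trace = 0) : ‖X‖ ≤ ‖X + Y‖ := by
  have h' : (Yᵀ * X).trace = 0 := by
    rw [← Matrix.trace_transpose, transpose_mul, transpose_transpose, h]
  refine le_of_pow_le_pow_left₀ two_ne_zero (norm_nonneg _) ?_
  have hY := sq_nonneg ‖Y‖
  rw [frobenius_norm_sq_eq_trace] at hY
  rw [frobenius_norm_sq_eq_trace, frobenius_norm_sq_eq_trace, transpose_add, Matrix.add_mul,
    Matrix.mul_add, Matrix.mul_add, trace_add, trace_add, trace_add, h, h']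
  linarith

/-- For symmetric idempotents `A` and `B`, the residual of
`G ↦ G B - A G B + A G` is Frobenius-orthogonal to the range of that map. -/
lemma trace_residual_transpose_mul_eq_zero {n R : Type*} [Fintype n] [DecidableEq n] [CommRing R]
    {A B : Matrix n n R} (hAt : Aᵀ = A) (hA : A * A = A) (hBt : Bᵀ = B) (hB : B * B = B)
    (G H : Matrix n n R) :
    ((G - (G * B - A * G * B + A * G))ᵀ * (H * B - A * H * B + A * H)).trace = 0 := by
  have hres : G - (G * B - A * G * B + A * G) = (1 - A) * G * (1 - B) := by noncomm_ring
  have hA' : (1 - A) * A = 0 := by rw [Matrix.sub_mul, Matrix.one_mul, hA, sub_self]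
  have hB' : B * (1 - B) = 0 := by rw [Matrix.mul_sub, Matrix.mul_one, hB, sub_self]
  have hran : (1 - A) * (H * B - A * H * B + A * H) = (1 - A) * H * B := by
    calc _ = (1 - A) * H * B - (1 - A) * A * H * B + (1 - A) * A * H := by noncomm_ring
      _ = _ := by simp [hA']
  rw [hres, transpose_mul, transpose_mul, transpose_sub, transpose_sub, transpose_one, hAt, hBt,
    Matrix.mul_assoc, Matrix.mul_assoc, hran, ← Matrix.mul_assoc, ← Matrix.mul_assoc,
    trace_mul_comm, ← Matrix.mul_assoc, ← Matrix.mul_assoc, ← Matrix.mul_assoc, hB']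
  simp

/-- Best-approximation property of the tangent-space projection
`P(G) = G V Vᵀ − U Uᵀ G V Vᵀ + U Uᵀ G`: `P G` minimizes the Frobenius-norm distance to `G`
over the range of `P`; equivalently, `G − P G` is Frobenius-orthogonal to the range of `P`. -/
theorem stmt_17 (d r : ℕ) (U V : Matrix (Fin d) (Fin r) ℝ)
    (hU : Uᵀ * U = 1) (hV : Vᵀ * V = 1)
    (P : Matrix (Fin d) (Fin d) ℝ → Matrix (Fin d) (Fin d) ℝ)
    (hP : ∀ G, P G = G * V * Vᵀ - U * Uᵀ * G * V * Vᵀ + U * Uᵀ * G) :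
    ∀ G : Matrix (Fin d) (Fin d) ℝ, ∀ W ∈ Set.range P,
      ‖G - P G‖ ≤ ‖G - W‖ ∧ ((G - P G)ᵀ * W).trace = 0 := by
  have proj_symm (Q : Matrix (Fin d) (Fin r) ℝ) : (Q * Qᵀ)ᵀ = Q * Qᵀ := by simp
  have proj_idem {Q : Matrix (Fin d) (Fin r) ℝ} (hQ : Qᵀ * Q = 1) :
      Q * Qᵀ * (Q * Qᵀ) = Q * Qᵀ := by
    rw [Matrix.mul_assoc, ← Matrix.mul_assoc Qᵀ, hQ, Matrix.one_mul]
  have hP' (G) : P G = G * (V * Vᵀ) - U * Uᵀ * G * (V * Vᵀ) + U * Uᵀ * G := by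
    rw [hP, Matrix.mul_assoc G, Matrix.mul_assoc (U * Uᵀ * G)]
  have horth (G H) : ((G - P G)ᵀ * P H).trace = 0 := by
    rw [hP', hP']
    exact trace_residual_transpose_mul_eq_zero (proj_symm U) (proj_idem hU) (proj_symm V)
      (proj_idem hV) G H
  rintro G _ ⟨H, rfl⟩
  refine ⟨?_, horth G H⟩
  have h : ((G - P G)ᵀ * (P G - P H)).trace = 0 := by
    rw [Matrix.mul_sub, trace_sub, horth, horth, sub_self]
  simpa using frobenius_norm_le_norm_add_of_trace_eq_zero h
end
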